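/- Let the outcome take K ≥ 2 values: Y(0), Y(1) : Ω → 𝒴 = {y₁, …, y_K} and Y := Y(D) (equal to Y(1) on {D = 1} and Y(0) on {D = 0}). Fix x ∈ 𝒳 with P(X = x) > 0 and suppose: (Randomization) under P(·|S = e, X = x), D is independent of the pair (Y(0), Y(1)); (Positivity) P(S = e, X = x, D = d, Y = y_j) > 0 and P(S = o, X = x, Y = y_j) > 0 for all d ∈ {0, 1} and j ∈ {1, …, K}; (Stability) R is conditionally independent of S given (X, D, Y); (No direct effect) R is conditionally independent of D given (X, Y). Define μ(d, x) ∈ ℝ^{K−1} with j-th entry P(Y(d) = y_j | S = e, X = x), the scalar Δᵉ(d) := 1{D = d, S = e}/P(D = d, S = e | X = x) − 1{Y = y_K, S = o}/P(Y = y_K, S = o | X = x), and the ℝ^{K−1}-valued Δᵒ with j-th entry 1{Y = y_j, S = o}/P(Y = y_j, S = o | X = x) − 1{Y = y_K, S = o}/P(Y = y_K, S = o | X = x). Then for each d ∈ {0, 1}, the conditional expectation of Δᵉ(d) − ⟨Δᵒ, μ(d, x)⟩ given σ(R), computed under P_x := P(·|X = x), equals 0 P_x-almost surely. -/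

import Mathlib

open MeasureTheory ProbabilityTheory

noncomputable section

/-- Sample indicator values: experimental (`e`) or observational (`o`). -/
inductive Sample : Type
  | e
  | o
deriving DecidableEq

instance : MeasurableSpace Sample := ⊤

/-- Real-valued indicator of a boolean (`{0,1}`-valued variable). -/
def b2r (b : Bool) : ℝ := if b then 1 else 0

/-- `CondIndepOf P R V W` : the conditional law of `R` given `V = v, W = w` agrees with
the conditional law of `R` given `V = v`, for all values with positive probability;
this is the notion of "R is conditionally independent of W given V" for variables with
countable ranges. -/
def CondIndepOf {Ω 𝓡 V W : Type*} [MeasurableSpace Ω] [MeasurableSpace 𝓡]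
    (P : Measure Ω) (R : Ω → 𝓡) (Vf : Ω → V) (Wf : Ω → W) : Prop :=
  ∀ v w, 0 < P {ω | Vf ω = v ∧ Wf ω = w} →
    (P[|{ω | Vf ω = v ∧ Wf ω = w}]).map R = (P[|{ω | Vf ω = v}]).map R

section Helpers

variable {Ω 𝓡 ι : Type*} [MeasurableSpace Ω] [MeasurableSpace 𝓡]

/-- A finite-valued measurable map partitions the mass of every set. -/
theorem sum_measureReal_inter_fiber [Fintype ι] [MeasurableSpace ι] [MeasurableSingletonClass ι]
    (μ : Measure Ω) [IsFiniteMeasure μ] {f : Ω → ι} (hf : Measurable f)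
    (A : Set Ω) : ∑ i, μ.real (A ∩ {ω | f ω = i}) = μ.real A := by
  have h := sum_measureReal_preimage_singleton (μ := μ.restrict A) (f := f) Finset.univ
    (fun i _ => hf (measurableSet_singleton i))
  simp only [Finset.coe_univ, Set.preimage_univ, measureReal_restrict_apply MeasurableSet.univ,
    Set.univ_inter] at h
  rw [← h]
  refine Finset.sum_congr rfl fun i _ => ?_
  rw [measureReal_restrict_apply (hf (measurableSet_singleton i)), Set.inter_comm]
  rfl

theorem cond_measureReal_apply {A : Set Ω} (hA : MeasurableSet A) (μ : Measure Ω) (B : Set Ω) :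
    (μ[|A]).real B = (μ.real A)⁻¹ * μ.real (A ∩ B) := by
  rw [measureReal_def, cond_apply hA, ENNReal.toReal_mul, ENNReal.toReal_inv]
  rfl

theorem measureReal_inter_eq_mul_cond (μ : Measure Ω) [IsFiniteMeasure μ] {A : Set Ω}
    (hA : MeasurableSet A) (B : Set Ω) : μ.real (A ∩ B) = μ.real A * (μ[|A]).real B := by
  rw [cond_measureReal_apply hA]
  rcases eq_or_ne (μ.real A) 0 with h | h
  · rw [h, zero_mul]
    exact measureReal_mono_null Set.inter_subset_left h
  · rw [mul_inv_cancel_left₀ h]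

theorem CondIndepOf.cond_real_eq {V W : Type*} {P : Measure Ω} {R : Ω → 𝓡} {Vf : Ω → V}
    {Wf : Ω → W} (h : CondIndepOf P R Vf Wf) (hR : Measurable R) {B : Set 𝓡}
    (hB : MeasurableSet B) {v : V} {w : W} (hpos : 0 < P {ω | Vf ω = v ∧ Wf ω = w}) :
    (P[|{ω | Vf ω = v ∧ Wf ω = w}]).real (R ⁻¹' B) = (P[|{ω | Vf ω = v}]).real (R ⁻¹' B) := by
  rw [← map_measureReal_apply hR hB, h v w hpos, map_measureReal_apply hR hB]

/-- A product rule on each cell of a finite partition, with a constant factor, passes to the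
whole set. -/
theorem measureReal_inter_eq_mul_of_fiber [Fintype ι] [MeasurableSpace ι]
    [MeasurableSingletonClass ι] (μ : Measure Ω) [IsFiniteMeasure μ] {f : Ω → ι}
    (hf : Measurable f) {A C : Set Ω} {c : ℝ}
    (h : ∀ i, μ.real (C ∩ (A ∩ {ω | f ω = i})) = c * μ.real (A ∩ {ω | f ω = i})) :
    μ.real (C ∩ A) = c * μ.real A := by
  rw [← sum_measureReal_inter_fiber μ hf (C ∩ A), ← sum_measureReal_inter_fiber μ hf A,
    Finset.mul_sum]
  simp_rw [Set.inter_assoc, h]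

theorem setIntegral_ite_one_zero_div (μ : Measure Ω) (p : Ω → Prop) [DecidablePred p]
    (hp : MeasurableSet {ω | p ω}) (A : Set Ω) (c : ℝ) :
    ∫ ω in A, (if p ω then (1 : ℝ) else 0) / c ∂μ = μ.real (A ∩ {ω | p ω}) / c := by
  rw [integral_div]
  have : (fun ω => if p ω then (1 : ℝ) else 0) = {ω | p ω}.indicator 1 := by
    ext ω; simp [Set.indicator_apply]
  rw [this, integral_indicator_one hp, measureReal_restrict_apply hp, Set.inter_comm]

theorem integrable_ite_one_zero_div (μ : Measure Ω) [IsFiniteMeasure μ] (p : Ω → Prop)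
    [DecidablePred p] (hp : MeasurableSet {ω | p ω}) (c : ℝ) :
    Integrable (fun ω => (if p ω then (1 : ℝ) else 0) / c) μ := by
  refine Integrable.div_const ?_ c
  have : (fun ω => if p ω then (1 : ℝ) else 0) = {ω | p ω}.indicator 1 := by
    ext ω; simp [Set.indicator_apply]
  rw [this]
  exact (integrable_const (1 : ℝ)).indicator hp

/-- If `R` is conditionally independent of `S` given `(X, D, Y)` and of `D` given `(X, Y)`, then
within `X = x` the event `R ∈ B` and the value of `(D, S)` decouple given `Y`. -/
theorem measureReal_inter_eq_of_stability {𝓧 𝓨 𝓓 𝓢 : Type*} {P : Measure Ω} [IsFiniteMeasure P]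
    {R : Ω → 𝓡} {X : Ω → 𝓧} {Y : Ω → 𝓨} {D : Ω → 𝓓} {S : Ω → 𝓢} (hR : Measurable R)
    (stability : CondIndepOf P R (fun ω => (X ω, D ω, Y ω)) S)
    (noDirectEffect : CondIndepOf P R (fun ω => (X ω, Y ω)) D) {x : 𝓧} {y : 𝓨} {d : 𝓓} {s : 𝓢}
    (hA : MeasurableSet {ω | (X ω, D ω, Y ω) = (x, d, y) ∧ S ω = s}) {B : Set 𝓡}
    (hB : MeasurableSet B) :
    P.real ({ω | (X ω, D ω, Y ω) = (x, d, y) ∧ S ω = s} ∩ R ⁻¹' B) =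
      (P[|{ω | (X ω, Y ω) = (x, y)}]).real (R ⁻¹' B) *
        P.real {ω | (X ω, D ω, Y ω) = (x, d, y) ∧ S ω = s} := by
  rcases eq_or_ne (P {ω | (X ω, D ω, Y ω) = (x, d, y) ∧ S ω = s}) 0 with h | h
  · have h' : P.real {ω | (X ω, D ω, Y ω) = (x, d, y) ∧ S ω = s} = 0 := by
      rw [measureReal_def, h, ENNReal.toReal_zero]
    rw [h', mul_zero]
    exact measureReal_mono_null Set.inter_subset_left h'
  · have hset : {ω | (X ω, D ω, Y ω) = (x, d, y)} = {ω | (X ω, Y ω) = (x, y) ∧ D ω = d} := by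
      ext ω; simp only [Set.mem_ofPred_eq, Prod.mk.injEq]; tauto
    have hpos : 0 < P {ω | (X ω, Y ω) = (x, y) ∧ D ω = d} := by
      rw [← hset]
      exact (pos_iff_ne_zero.2 h).trans_le (measure_mono fun ω hω => hω.1)
    rw [measureReal_inter_eq_mul_cond P hA,
      stability.cond_real_eq hR hB (pos_iff_ne_zero.2 h), hset,
      noDirectEffect.cond_real_eq hR hB hpos, mul_comm]

end Helpers

/-- **Theorem (Identification as conditional moment), discrete outcome with K = n+1 ≥ 2
values.** The outcome takes values in `Fin (n+1)` (the values `y₁,…,y_K`, with `y_K`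
corresponding to `Fin.last n`); under randomization, positivity, stability and no direct
effect, `E_{P_x}[Δᵉ(d) − ⟨Δᵒ, μ(d,x)⟩ | σ(R)] = 0` `P_x`-a.s. -/
theorem statement10
    {Ω 𝓡 𝓧 : Type*} [MeasurableSpace Ω] [MeasurableSpace 𝓡] [StandardBorelSpace 𝓡]
    [MeasurableSpace 𝓧] [MeasurableSingletonClass 𝓧] [Countable 𝓧]
    (P : Measure Ω) [IsProbabilityMeasure P]
    (n : ℕ) (hn : 1 ≤ n)   -- K = n + 1 ≥ 2
    (S : Ω → Sample) (D : Ω → Bool) (Y0 Y1 : Ω → Fin (n + 1)) (R : Ω → 𝓡) (X : Ω → 𝓧)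
    (hS : Measurable S) (hD : Measurable D) (hY0 : Measurable Y0) (hY1 : Measurable Y1)
    (hR : Measurable R) (hX : Measurable X)
    (Y : Ω → Fin (n + 1)) (hYdef : ∀ ω, Y ω = if D ω then Y1 ω else Y0 ω)
    (x : 𝓧) (hx : 0 < P {ω | X ω = x})
    -- Randomization: D ⫫ (Y(0), Y(1)) under P(·|S = e, X = x)
    (randomization :
      IndepFun D (fun ω => (Y0 ω, Y1 ω)) (P[|{ω | S ω = Sample.e ∧ X ω = x}]))
    -- Positivity
    (positivity_e : ∀ (d : Bool) (j : Fin (n + 1)),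
      0 < P {ω | S ω = Sample.e ∧ X ω = x ∧ D ω = d ∧ Y ω = j})
    (positivity_o : ∀ j : Fin (n + 1),
      0 < P {ω | S ω = Sample.o ∧ X ω = x ∧ Y ω = j})
    -- Stability: R ⫫ S | (X, D, Y)
    (stability : CondIndepOf P R (fun ω => (X ω, D ω, Y ω)) S)
    -- No direct effect: R ⫫ D | (X, Y)
    (noDirectEffect : CondIndepOf P R (fun ω => (X ω, Y ω)) D)
    (d : Bool)
    -- μ(d, x) ∈ ℝ^{K−1}, with j-th entry P(Y(d) = y_j | S = e, X = x)
    (μ : Fin n → ℝ)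
    (hμ : ∀ j : Fin n, μ j =
      ((P[|{ω | S ω = Sample.e ∧ X ω = x}])
        {ω | (if d then Y1 ω else Y0 ω) = j.castSucc}).toReal)
    -- Δᵉ(d) := 1{D=d,S=e}/P(D=d,S=e|X=x) − 1{Y=y_K,S=o}/P(Y=y_K,S=o|X=x)
    (Δe : Ω → ℝ)
    (hΔe : ∀ ω, Δe ω =
      (if D ω = d ∧ S ω = Sample.e then (1 : ℝ) else 0) /
        ((P[|{ω' | X ω' = x}]) {ω' | D ω' = d ∧ S ω' = Sample.e}).toReal -
      (if Y ω = Fin.last n ∧ S ω = Sample.o then (1 : ℝ) else 0) /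
        ((P[|{ω' | X ω' = x}]) {ω' | Y ω' = Fin.last n ∧ S ω' = Sample.o}).toReal)
    -- Δᵒ ∈ ℝ^{K−1}, with j-th entry
    -- 1{Y=y_j,S=o}/P(Y=y_j,S=o|X=x) − 1{Y=y_K,S=o}/P(Y=y_K,S=o|X=x)
    (Δo : Fin n → Ω → ℝ)
    (hΔo : ∀ (j : Fin n) (ω), Δo j ω =
      (if Y ω = j.castSucc ∧ S ω = Sample.o then (1 : ℝ) else 0) /
        ((P[|{ω' | X ω' = x}]) {ω' | Y ω' = j.castSucc ∧ S ω' = Sample.o}).toReal -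
      (if Y ω = Fin.last n ∧ S ω = Sample.o then (1 : ℝ) else 0) /
        ((P[|{ω' | X ω' = x}]) {ω' | Y ω' = Fin.last n ∧ S ω' = Sample.o}).toReal) :
    (P[|{ω | X ω = x}])[(fun ω => Δe ω - ∑ j : Fin n, Δo j ω * μ j) |
        MeasurableSpace.comap R inferInstance]
      =ᵐ[P[|{ω | X ω = x}]] 0 := by
  have hSs : ∀ s, MeasurableSet {ω | S ω = s} := fun s => hS (t := {s}) trivial
  have hDs : ∀ d, MeasurableSet {ω | D ω = d} := fun d => hD (measurableSet_singleton d)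
  have hXx : MeasurableSet {ω | X ω = x} := hX (measurableSet_singleton x)
  have hY : Measurable Y := by
    rw [funext hYdef]
    exact Measurable.ite (hDs true) hY1 hY0
  have hYs : ∀ j, MeasurableSet {ω | Y ω = j} := fun j => hY (measurableSet_singleton j)
  have hDS : MeasurableSet {ω | D ω = d ∧ S ω = Sample.e} := (hDs d).inter (hSs _)
  have hYS : ∀ j, MeasurableSet {ω | Y ω = j ∧ S ω = Sample.o} := fun j => (hYs j).inter (hSs _)
  have hC : MeasurableSet {ω | S ω = Sample.e ∧ X ω = x} := (hSs _).inter hXx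
  have hCpos : 0 < P {ω | S ω = Sample.e ∧ X ω = x} :=
    (positivity_e d 0).trans_le (measure_mono fun ω hω => ⟨hω.1, hω.2.1⟩)
  set Yd : Ω → Fin (n + 1) := fun ω => if d then Y1 ω else Y0 ω with hYd
  have hYdm : Measurable Yd := by
    cases d
    · simpa [hYd] using hY0
    · simpa [hYd] using hY1
  set Q : Measure Ω := P[|{ω | X ω = x}]
  set Pe : Measure Ω := P[|{ω | S ω = Sample.e ∧ X ω = x}] with hPe
  have : IsProbabilityMeasure Q := cond_isProbabilityMeasure hx.ne'
  have : IsProbabilityMeasure Pe := cond_isProbabilityMeasure hCpos.ne'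
  have hQapp : ∀ A, Q.real A = (P.real {ω | X ω = x})⁻¹ * P.real ({ω | X ω = x} ∩ A) :=
    fun A => cond_measureReal_apply hXx P A
  have hQpos : ∀ A, 0 < P ({ω | X ω = x} ∩ A) → 0 < Q.real A := fun A hA => by
    rw [hQapp]
    exact mul_pos (inv_pos.2 (ENNReal.toReal_pos hx.ne' (measure_ne_top _ _)))
      (ENNReal.toReal_pos hA.ne' (measure_ne_top _ _))
  set m : Fin (n + 1) → ℝ := fun j => Pe.real {ω | Yd ω = j}
  have hμm : ∀ j, μ j = m j.castSucc := hμ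
  have hmsum : ∑ j : Fin n, m j.castSucc + m (Fin.last n) = 1 := by
    rw [← Fin.sum_univ_castSucc]
    simpa using sum_measureReal_inter_fiber Pe hYdm Set.univ
  have hrand : ∀ j, Q.real {ω | (D ω = d ∧ S ω = Sample.e) ∧ Y ω = j} =
      Q.real {ω | D ω = d ∧ S ω = Sample.e} * m j := by
    intro j
    have hind : IndepFun D Yd Pe := by
      cases d
      · simpa [hYd, Function.comp_def] using randomization.comp measurable_id measurable_fst
      · simpa [hYd, Function.comp_def] using randomization.comp measurable_id measurable_snd
    have h1 : Pe.real ({ω | D ω = d} ∩ {ω | Yd ω = j}) = Pe.real {ω | D ω = d} * m j := by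
      have h := hind.measure_inter_preimage_eq_mul {d} {j} (measurableSet_singleton d)
        (measurableSet_singleton j)
      exact (congrArg ENNReal.toReal h).trans (ENNReal.toReal_mul ..)
    have h2 := measureReal_inter_eq_mul_cond P hC ({ω | D ω = d} ∩ {ω | Yd ω = j})
    have h3 := measureReal_inter_eq_mul_cond P hC {ω | D ω = d}
    have e1 : {ω | X ω = x} ∩ {ω | (D ω = d ∧ S ω = Sample.e) ∧ Y ω = j} =
        {ω | S ω = Sample.e ∧ X ω = x} ∩ ({ω | D ω = d} ∩ {ω | Yd ω = j}) := by
      ext ω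
      simp only [Set.mem_inter_iff, Set.mem_ofPred_eq, hYd, hYdef]
      constructor
      · rintro ⟨hX, ⟨rfl, hS⟩, hY⟩
        exact ⟨⟨hS, hX⟩, rfl, hY⟩
      · rintro ⟨⟨hS, hX⟩, rfl, hY⟩
        exact ⟨hX, ⟨rfl, hS⟩, hY⟩
    have e2 : {ω | X ω = x} ∩ {ω | D ω = d ∧ S ω = Sample.e} =
        {ω | S ω = Sample.e ∧ X ω = x} ∩ {ω | D ω = d} := by
      ext ω; simp only [Set.mem_inter_iff, Set.mem_ofPred_eq]; tauto
    rw [hQapp, hQapp, e1, e2, h2, h3, ← hPe, h1]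
    ring
  have hm' : MeasurableSpace.comap R inferInstance ≤ (inferInstance : MeasurableSpace Ω) :=
    hR.comap_le
  have hi_e := integrable_ite_one_zero_div Q _ hDS (Q.real {ω | D ω = d ∧ S ω = Sample.e})
  have hi_o := fun j => integrable_ite_one_zero_div Q _ (hYS j)
    (Q.real {ω | Y ω = j ∧ S ω = Sample.o})
  have hΔei : Integrable Δe Q := by
    rw [funext hΔe]
    exact hi_e.sub (hi_o _)
  have hΔoi : ∀ j, Integrable (Δo j) Q := fun j => by
    rw [funext (hΔo j)]
    exact (hi_o _).sub (hi_o _)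
  have hsumi : ∀ j ∈ Finset.univ, Integrable (fun ω => Δo j ω * μ j) Q :=
    fun j _ => (hΔoi j).mul_const _
  refine (ae_eq_condExp_of_forall_setIntegral_eq hm' (hΔei.sub (integrable_finsetSum _ hsumi))
    (fun _ _ _ => integrableOn_zero) ?_ aestronglyMeasurable_zero).symm
  rintro _ ⟨B, hB, rfl⟩ -
  have hRB := hR hB
  set L : Fin (n + 1) → ℝ := fun j => (P[|{ω | (X ω, Y ω) = (x, j)}]).real (R ⁻¹' B)
  have hcell : ∀ d' j s, Q.real (R ⁻¹' B ∩ {ω | D ω = d' ∧ Y ω = j ∧ S ω = s}) =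
      L j * Q.real {ω | D ω = d' ∧ Y ω = j ∧ S ω = s} := by
    intro d' j s
    have e : {ω | (X ω, D ω, Y ω) = (x, d', j) ∧ S ω = s} =
        {ω | X ω = x} ∩ {ω | D ω = d' ∧ Y ω = j ∧ S ω = s} := by
      ext ω; simp only [Set.mem_inter_iff, Set.mem_ofPred_eq, Prod.mk.injEq]; tauto
    have h := measureReal_inter_eq_of_stability (x := x) (y := j) (d := d') (s := s) hR stability
      noDirectEffect (by rw [e]; exact hXx.inter ((hDs d').inter ((hYs j).inter (hSs s)))) hB
    rw [e] at h
    rw [hQapp, hQapp, Set.inter_comm (R ⁻¹' B), ← Set.inter_assoc, h]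
    ring
  have ho : ∀ j, Q.real (R ⁻¹' B ∩ {ω | Y ω = j ∧ S ω = Sample.o}) /
      Q.real {ω | Y ω = j ∧ S ω = Sample.o} = L j := by
    intro j
    have hpos : 0 < Q.real {ω | Y ω = j ∧ S ω = Sample.o} := hQpos _ <|
      (positivity_o j).trans_le (measure_mono fun ω hω => ⟨hω.2.1, hω.2.2, hω.1⟩)
    rw [div_eq_iff hpos.ne']
    refine measureReal_inter_eq_mul_of_fiber Q hD fun d' => ?_
    have e : {ω | Y ω = j ∧ S ω = Sample.o} ∩ {ω | D ω = d'} =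
        {ω | D ω = d' ∧ Y ω = j ∧ S ω = Sample.o} := by
      ext ω; simp only [Set.mem_inter_iff, Set.mem_ofPred_eq]; tauto
    rw [e, hcell]
  have he : Q.real (R ⁻¹' B ∩ {ω | D ω = d ∧ S ω = Sample.e}) /
      Q.real {ω | D ω = d ∧ S ω = Sample.e} =
        ∑ j : Fin n, L j.castSucc * m j.castSucc + L (Fin.last n) * m (Fin.last n) := by
    have hpos : 0 < Q.real {ω | D ω = d ∧ S ω = Sample.e} := hQpos _ <|
      (positivity_e d 0).trans_le (measure_mono fun ω hω => ⟨hω.2.1, hω.2.2.1, hω.1⟩)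
    rw [div_eq_iff hpos.ne', ← Fin.sum_univ_castSucc (f := fun j => L j * m j),
      ← sum_measureReal_inter_fiber Q hY (R ⁻¹' B ∩ _), Finset.sum_mul]
    refine Finset.sum_congr rfl fun j _ => ?_
    have e : {ω | D ω = d ∧ S ω = Sample.e} ∩ {ω | Y ω = j} =
        {ω | D ω = d ∧ Y ω = j ∧ S ω = Sample.e} := by
      ext ω; simp only [Set.mem_inter_iff, Set.mem_ofPred_eq]; tauto
    rw [Set.inter_assoc, e, hcell, ← e]
    have := hrand j
    rw [Set.ofPred_and] at this
    rw [this]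
    ring
  have hIo : ∀ j, ∫ ω in R ⁻¹' B, Δo j ω ∂Q = L j.castSucc - L (Fin.last n) := fun j => by
    simp_rw [hΔo j]
    rw [← ho j.castSucc, ← ho (Fin.last n), ← setIntegral_ite_one_zero_div Q _ (hYS _),
      ← setIntegral_ite_one_zero_div Q _ (hYS _)]
    exact integral_sub (hi_o _).integrableOn (hi_o _).integrableOn
  have hIe : ∫ ω in R ⁻¹' B, Δe ω ∂Q = ∑ j : Fin n, L j.castSucc * m j.castSucc +
      L (Fin.last n) * m (Fin.last n) - L (Fin.last n) := by
    simp_rw [hΔe]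
    rw [← he, ← ho (Fin.last n), ← setIntegral_ite_one_zero_div Q _ hDS,
      ← setIntegral_ite_one_zero_div Q _ (hYS _)]
    exact integral_sub hi_e.integrableOn (hi_o _).integrableOn
  rw [integral_sub' hΔei.integrableOn (integrable_finsetSum _ hsumi).integrableOn,
    integral_finsetSum _ fun j hj => (hsumi j hj).integrableOn, hIe]
  simp_rw [integral_mul_const, hIo, hμm, sub_mul, Finset.sum_sub_distrib, ← Finset.mul_sum]
  simp only [integral_zero]
  linear_combination (-L (Fin.last n)) * hmsum
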